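/- Let k be a field, let R and S be finitely generated commutative k-algebras that are integral domains of Krull dimension one, and let σ and σ' be k-algebra automorphisms of R and S respectively. Let T be a skew polynomial ring R[x;σ] (a k-algebra with an injective k-algebra homomorphism ι : R → T and an element x ∈ T such that every element of T is uniquely a finite sum Σ_i ι(r_i)x^i and x·ι(r) = ι(σ(r))·x for all r ∈ R), and let T' be a skew polynomial ring S[x';σ'] defined analogously. If T and T' are isomorphic as k-algebras, then R and S are isomorphic as k-algebras. -/

import Mathlib

universe u v

section AuxAll
open Polynomial

theorem aux_trdeg {k R : Type*} [Field k] [CommRing R] [IsDomain R] [Algebra k R]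
    (hfg : Algebra.FiniteType k R) (hdim : ringKrullDim R = 1) : Algebra.trdeg k R ≤ 1 := by
  obtain ⟨s, g, hg, hint⟩ := exists_integral_inj_algHom_of_fg k R
  have hK : Ring.KrullDimLE 1 R := by
    rw [Ring.krullDimLE_iff, hdim]; rfl
  have hs : s ≤ 1 := by
    by_contra hs
    push Not at hs
    let i0 : Fin s := ⟨0, by omega⟩
    let i1 : Fin s := ⟨1, hs⟩
    have hne : i1 ≠ i0 := by simp [i0, i1]
    let θ : MvPolynomial (Fin s) k →ₐ[k] MvPolynomial (Fin s) k :=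
      MvPolynomial.aeval (fun i => if i = i0 then 0 else MvPolynomial.X i)
    let P : Ideal (MvPolynomial (Fin s) k) := RingHom.ker θ
    have hP : P.IsPrime := RingHom.ker_isPrime _
    let _ := g.toRingHom.toAlgebra
    have : Algebra.IsIntegral (MvPolynomial (Fin s) k) R := ⟨hint⟩
    obtain ⟨Q, hQ1, hQ, hQP⟩ := Ideal.exists_ideal_over_prime_of_isIntegral (S := R) P ⊥ (by
      intro z hz
      have : g z = 0 := hz
      have : z = 0 := hg (by simpa using this)
      simp [this])
    have hX : MvPolynomial.X i0 ∈ P := by simp [P, θ, RingHom.mem_ker]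
    have hQb : Q ≠ ⊥ := by
      rintro rfl
      rw [← hQP] at hX
      have : g (MvPolynomial.X i0) = 0 := hX
      exact MvPolynomial.X_ne_zero (R := k) i0 (hg (by simpa using this))
    have hQm : Q.IsMaximal := hQ.isMaximal_of_ne_bot hQb
    have hPm : P.IsMaximal := by
      rw [← hQP]
      exact Ideal.isMaximal_comap_of_isIntegral_of_isMaximal Q
    have hle : P ≤ RingHom.ker (MvPolynomial.constantCoeff (R := k) (σ := Fin s)) := by
      have hcomp : (MvPolynomial.aeval (fun _ => (0:k))).comp θ =
          (MvPolynomial.aeval (fun _ : Fin s => (0:k))) := by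
        ext i; by_cases hi : i = i0 <;> simp [θ, hi]
      intro z hz
      have hz : θ z = 0 := hz
      have := congrArg (fun f => f z) hcomp
      simp only [AlgHom.comp_apply, hz, map_zero] at this
      rw [RingHom.mem_ker]
      simpa [MvPolynomial.aeval_def, MvPolynomial.eval₂_zero_apply] using this.symm
    have heq := hPm.eq_of_le (RingHom.ker_ne_top _) hle
    have h1 : MvPolynomial.X i1 ∈ P := by rw [heq]; simp [RingHom.mem_ker]
    have h1 : θ (MvPolynomial.X i1) = 0 := h1
    simp [θ, hne] at h1
  let y : Fin s → R := fun i => g (MvPolynomial.X i)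
  have hrange : (g.range : Set R) = Algebra.adjoin k (Set.range y) := by
    have : g = MvPolynomial.aeval y := by ext; simp [y]
    rw [Algebra.adjoin_range_eq_range_aeval, this]
  have : Algebra.IsAlgebraic (Algebra.adjoin k (Set.range y)) R := by
    constructor
    intro r
    have : IsIntegral (Algebra.adjoin k (Set.range y)) r := by
      obtain ⟨p, hp, hp2⟩ := hint r
      let g' : MvPolynomial (Fin s) k →+* Algebra.adjoin k (Set.range y) :=
        g.toRingHom.codRestrict (Algebra.adjoin k (Set.range y)) (fun z => by
          have : g z ∈ (g.range : Set R) := ⟨z, rfl⟩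
          rw [hrange] at this; exact this)
      refine ⟨p.map g', hp.map _, ?_⟩
      rw [eval₂_map]; exact hp2
    exact this.isAlgebraic
  refine (Algebra.IsAlgebraic.trdeg_le_cardinalMk k (Set.range y)).trans ?_
  have h1 := Cardinal.mk_range_le_lift (f := y)
  simp only [Cardinal.mk_fin, Cardinal.lift_natCast] at h1
  rw [Cardinal.lift_uzero] at h1
  exact h1.trans (by exact_mod_cast hs)

theorem aux_binom {p : ℕ} [Fact p.Prime] (v m : ℕ) (hm : ¬ p ∣ m) :
    ¬ p ∣ (p ^ v * m).choose (p ^ v) := by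
  have key : (p ^ v * m).choose (p ^ v) ≡ m [MOD p] := by
    induction v with
    | zero => simp; rfl
    | succ v ih =>
      have hp : 0 < p := (Fact.out : p.Prime).pos
      have h := Choose.choose_modEq_choose_mod_mul_choose_div_nat (p := p) (n := p ^ (v+1) * m) (k := p ^ (v+1))
      rw [pow_succ', mul_assoc] at h
      simp only [Nat.mul_mod_right, Nat.mul_div_cancel_left _ hp, Nat.choose_self, one_mul] at h
      rw [pow_succ', mul_assoc]
      exact h.trans ih
  intro h
  exact hm ((key.dvd_iff dvd_rfl).1 h)

/-- an exponential map -/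
structure IsExpMap {k R : Type*} [Field k] [CommRing R] [Algebra k R] (φ : R →ₐ[k] R[X]) : Prop where
  zero : ∀ r, (φ r).coeff 0 = r
  iter : ∀ r i j, (φ ((φ r).coeff j)).coeff i = ((i + j).choose i : R) * (φ r).coeff (i + j)

theorem aux_exp_digit {k R : Type*} [Field k] [CommRing R] [IsDomain R] [Algebra k R]
    (φ : R →ₐ[k] R[X]) (h : IsExpMap φ) (n m : ℕ) (hn : 0 < n) (hm : 0 < m)
    (hmin : ∀ r, 0 < (φ r).natDegree → n ≤ (φ r).natDegree)
    (r x : R) (hr : (φ r).natDegree = m) (hx : (φ x).natDegree = n) : n ∣ m := by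
  have key : ∀ (y : R) (s t : ℕ), (φ y).natDegree = s + t → 0 < s →
      (((s + t).choose s : ℕ) : R) ≠ 0 → n ≤ s := by
    intro y s t hy hs hc
    have hy0 : φ y ≠ 0 := by rintro h0; simp [h0] at hy; omega
    have hd : (φ ((φ y).coeff t)).natDegree = s := by
      apply le_antisymm
      · rw [natDegree_le_iff_coeff_eq_zero]
        intro N hN
        rw [h.iter, coeff_eq_zero_of_natDegree_lt (by omega), mul_zero]
      · apply le_natDegree_of_ne_zero
        rw [h.iter]
        refine mul_ne_zero hc ?_
        rw [← hy]; simpa using hy0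
    rw [← hd]; apply hmin; omega
  obtain ⟨p, hp⟩ := CharP.exists R
  rcases CharP.char_is_prime_or_zero R p with hpp | rfl
  · have : Fact p.Prime := ⟨hpp⟩
    have dec : ∀ y : R, 0 < (φ y).natDegree → ∃ v, p ^ v ∣ (φ y).natDegree ∧ n ≤ p ^ v := by
      intro y hy
      obtain ⟨v, m', hm', hv⟩ := Nat.exists_eq_pow_mul_and_not_dvd hy.ne' p hpp.ne_one
      refine ⟨v, ⟨m', hv⟩, ?_⟩
      have hle : p ^ v ≤ (φ y).natDegree := Nat.le_of_dvd hy ⟨m', hv⟩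
      apply key y (p ^ v) ((φ y).natDegree - p ^ v) (by omega) (pow_pos hpp.pos _)
      rw [Nat.add_sub_cancel' hle, hv, Ne, CharP.cast_eq_zero_iff R p]
      exact aux_binom v m' hm'
    obtain ⟨v, hv1, hv2⟩ := dec x (by omega)
    obtain ⟨u, hu1, hu2⟩ := dec r (by omega)
    rw [hx] at hv1
    have hnv : n = p ^ v := le_antisymm hv2 (Nat.le_of_dvd hn hv1)
    rw [hr] at hu1
    refine dvd_trans ?_ hu1
    rw [hnv] at hu2 ⊢
    exact pow_dvd_pow _ ((Nat.pow_le_pow_iff_right hpp.one_lt).1 hu2)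
  · have : CharZero R := CharP.charP_to_charZero R
    have : n ≤ 1 := key r 1 (m-1) (by omega) one_pos (by
      exact_mod_cast (Nat.choose_pos (by omega)).ne')
    have : n = 1 := by omega
    simp [this]

theorem aux_surj_inj {R S : Type*} [CommRing R] [IsDomain R] [CommRing S] [IsDomain S]
    (hR : Ring.KrullDimLE 1 R) (hS : ringKrullDim S = 1) (f : R →+* S)
    (hf : Function.Surjective f) : Function.Injective f := by
  rw [RingHom.injective_iff_ker_eq_bot]
  by_contra hne
  have hP : (RingHom.ker f).IsPrime := RingHom.ker_isPrime _
  have hM := hP.isMaximal_of_ne_bot hne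
  have hF : IsField S := by
    have := (Ideal.Quotient.maximal_ideal_iff_isField_quotient _).1 hM
    exact MulEquiv.isField this (RingHom.quotientKerEquivOfSurjective hf).symm.toMulEquiv
  rw [ringKrullDim_eq_zero_of_isField hF] at hS
  exact zero_ne_one hS

/-- `R` is a polynomial ring over a finite extension of `k`. -/
def IsPolyFin (k : Type*) (R : Type u) [Field k] [CommRing R] [Algebra k R] : Prop :=
  ∃ (L : Type u) (_ : Field L) (_ : Algebra k L), Module.Finite k L ∧ Nonempty (R ≃ₐ[k] L[X])

theorem aux_poly_of_surj {k R L : Type*} [Field k] [CommRing R] [IsDomain R] [Algebra k R]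
    [CommRing L] [Algebra k L] (hL : IsField L) (hdim : ringKrullDim R = 1)
    (f : L[X] →ₐ[k] R) (hf : Function.Surjective f) : Nonempty (L[X] ≃ₐ[k] R) := by
  let _ := hL.toField
  refine ⟨AlgEquiv.ofBijective f ⟨?_, hf⟩⟩
  exact aux_surj_inj (by
    have : Ring.DimensionLEOne L[X] := inferInstance
    infer_instance) hdim f.toRingHom hf

theorem aux_polyFin {k : Type*} {R : Type u} [Field k] [CommRing R] [IsDomain R] [Algebra k R]
    (hfg : Algebra.FiniteType k R) (hdim : ringKrullDim R = 1)
    (L : Subalgebra k R) (hL : IsField L) (x : R)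
    (hx : Function.Surjective (aeval (R := L) x)) : IsPolyFin k R := by
  obtain ⟨e⟩ := aux_poly_of_surj hL hdim ((aeval (R := L) x).restrictScalars k) hx
  let _ := hL.toField
  refine ⟨L, hL.toField, inferInstance, ?_, ⟨e.symm⟩⟩
  have : Algebra.FiniteType k L := by
    let g : R →ₐ[k] L := ((aeval (R := L) (0:L)).restrictScalars k).comp e.symm.toAlgHom
    refine hfg.of_surjective (f := g) ?_
    intro l
    refine ⟨e (C l), ?_⟩
    simp [g]
  exact finite_of_finite_type_of_isJacobsonRing k L

theorem aux_iso_of_polyFin {k : Type*} {R : Type u} {S : Type v} [Field k]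
    [CommRing R] [Algebra k R] [CommRing S] [Algebra k S]
    (hR : IsPolyFin k R) (hS : IsPolyFin k S)
    (f : R →ₐ[k] S[X]) (g : S →ₐ[k] R[X]) : Nonempty (R ≃ₐ[k] S) := by
  obtain ⟨L, _, _, hL, ⟨e⟩⟩ := hR
  obtain ⟨M, _, _, hM, ⟨e'⟩⟩ := hS
  let p : L →ₐ[k] M := ((aeval (R := M) (0:M)).restrictScalars k).comp (e'.toAlgHom.comp
    (((aeval (R := S) (0:S)).restrictScalars k).comp (f.comp (e.symm.toAlgHom.comp CAlgHom))))
  let q : M →ₐ[k] L := ((aeval (R := L) (0:L)).restrictScalars k).comp (e.toAlgHom.comp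
    (((aeval (R := R) (0:R)).restrictScalars k).comp (g.comp (e'.symm.toAlgHom.comp CAlgHom))))
  have h1 := LinearMap.finrank_le_finrank_of_injective (f := p.toLinearMap) p.toRingHom.injective
  have h2 := LinearMap.finrank_le_finrank_of_injective (f := q.toLinearMap) q.toRingHom.injective
  have hs : Function.Surjective p.toLinearMap :=
    (LinearMap.injective_iff_surjective_of_finrank_eq_finrank (le_antisymm h1 h2)).1
      p.toRingHom.injective
  let E : L ≃ₐ[k] M := AlgEquiv.ofBijective p ⟨p.toRingHom.injective, hs⟩
  exact ⟨(e.trans (mapAlgEquiv E)).trans e'.symm⟩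

theorem aux_exp_poly {k : Type*} {R : Type u} [Field k] [CommRing R] [IsDomain R] [Algebra k R]
    (hfg : Algebra.FiniteType k R) (hdim : ringKrullDim R = 1)
    (φ : R →ₐ[k] R[X]) (h : IsExpMap φ) (hnt : ∃ r, φ r ≠ C r) : IsPolyFin k R := by
  have hC : ∀ r, (φ r).natDegree = 0 → φ r = C r := by
    intro r hr
    rw [eq_C_of_natDegree_eq_zero hr, h.zero]
  have hinj : Function.Injective φ := by
    intro a b hab
    rw [← h.zero a, hab, h.zero]
  let L : Subalgebra k R := AlgHom.equalizer φ CAlgHom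
  have memL : ∀ r, r ∈ L ↔ φ r = C r := fun r => Iff.rfl
  have hex : ∃ n, 0 < n ∧ ∃ x, (φ x).natDegree = n := by
    obtain ⟨r, hr⟩ := hnt
    exact ⟨_, Nat.pos_of_ne_zero (fun h0 => hr (hC r h0)), r, rfl⟩
  classical
  obtain ⟨hn, x, hx⟩ := Nat.find_spec hex
  have hmin : ∀ r, 0 < (φ r).natDegree → Nat.find hex ≤ (φ r).natDegree :=
    fun r hr => Nat.find_min' hex ⟨hr, r, rfl⟩
  set n := Nat.find hex
  have hlead : ∀ r, (φ r).leadingCoeff ∈ L := by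
    intro r
    rw [memL]
    apply hC
    rw [← Nat.le_zero, natDegree_le_iff_coeff_eq_zero]
    intro N hN
    rw [leadingCoeff, h.iter, coeff_eq_zero_of_natDegree_lt (by omega), mul_zero]
  have hxtr : Transcendental L x := by
    rintro ⟨p, hp0, hp⟩
    have hcomp : φ.toRingHom.comp (algebraMap L R) = (C : R →+* R[X]).comp (algebraMap L R) := by
      ext1 l; exact l.2
    have h1 : φ (aeval x p) = (p.map (algebraMap L R)).comp (φ x) := by
      have := hom_eval₂ p (algebraMap L R) φ.toRingHom x
      rw [hcomp] at this
      rw [comp, eval₂_map]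
      exact this
    rw [hp, map_zero, eq_comm, comp_eq_zero_iff] at h1
    rcases h1 with h1 | h1
    · exact hp0 ((Polynomial.map_eq_zero_iff Subtype.val_injective).1 h1)
    · have := h1.2
      rw [this, natDegree_C] at hx
      omega
  have hLf : IsField L := by
    have : Algebra.IsAlgebraic k L := by
      constructor
      rintro ⟨a, ha⟩
      by_contra htr
      have htr : Transcendental k a := by
        intro hal
        apply htr
        exact (isAlgebraic_algHom_iff L.val Subtype.val_injective).1 hal
      have hai : AlgebraicIndependent k (fun _ : PUnit.{u+1} => a) :=
        algebraicIndependent_unique_type_iff.2 htr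
      have hb := hai.isTranscendenceBasis_of_trdeg_le_of_finite
        ((aux_trdeg hfg hdim).trans (by simp))
      have hal := (hb.isAlgebraic).isAlgebraic x
      apply hxtr
      have hle : Algebra.adjoin k (Set.range fun _ : PUnit.{u+1} => a) ≤ L := by
        rw [Algebra.adjoin_le_iff]; rintro _ ⟨_, rfl⟩; exact ha
      obtain ⟨p, hp0, hp⟩ := hal
      refine ⟨p.map (Subalgebra.inclusion hle).toRingHom, ?_, ?_⟩
      · exact (Polynomial.map_ne_zero_iff (Subalgebra.inclusion_injective hle)).2 hp0
      · rw [aeval_def, eval₂_map]; exact hp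
    exact isField_of_isIntegral_of_isField' (R := k) (Field.toIsField k)
  refine aux_polyFin hfg hdim L hLf x ?_
  suffices H : ∀ m r, (φ r).natDegree = m → ∃ p, aeval (R := L) x p = r from
    fun r => H _ r rfl
  intro m
  induction m using Nat.strong_induction_on with
  | _ m ih =>
  intro r hr
  rcases Nat.eq_zero_or_pos m with rfl | hm
  · exact ⟨C ⟨r, hC r hr⟩, by simp⟩
  obtain ⟨q, hq⟩ := aux_exp_digit φ h n m hn hm hmin r x hr hx
  have hx0 : φ x ≠ 0 := by intro h0; simp [h0] at hx; omega
  have hc0 : (⟨_, hlead x⟩ : L) ≠ 0 := by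
    intro h0; apply hx0; rw [← leadingCoeff_eq_zero]; exact congrArg Subtype.val h0
  obtain ⟨d, hd⟩ := hLf.mul_inv_cancel hc0
  have hd' : (φ x).leadingCoeff * (d:R) = 1 := congrArg Subtype.val hd
  have hr0 : r ≠ 0 := by rintro rfl; simp at hr; omega
  have hrφ : φ r ≠ 0 := by intro h0; simp [h0] at hr; omega
  let a : L := ⟨_, hlead r⟩ * d ^ q
  have ha : φ (a : R) = C (a : R) := a.2
  have hav : (a : R) = (φ r).leadingCoeff * (d:R)^q := rfl
  have hd0 : (d:R) ≠ 0 := by rintro h0; simp [h0] at hd'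
  have ha0 : (a:R) ≠ 0 := by
    rw [hav]; exact mul_ne_zero (by simpa using hrφ) (pow_ne_zero _ hd0)
  have hφ : φ ((a:R) * x ^ q) = C (a:R) * φ x ^ q := by simp [ha]
  have hdeg : (C (a:R) * φ x ^ q).natDegree = m := by
    rw [natDegree_C_mul ha0, natDegree_pow, hx, hq, mul_comm]
  have hlc : (C (a:R) * φ x ^ q).leadingCoeff = (φ r).leadingCoeff := by
    rw [leadingCoeff_mul, leadingCoeff_pow, leadingCoeff_C, hav, mul_assoc, ← mul_pow, mul_comm (d:R),
      hd', one_pow, mul_one]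
  have hlt : (φ (r - (a:R) * x ^ q)).natDegree < m := by
    rw [map_sub, hφ]
    have h2 : (φ r).degree = (C (a:R) * φ x ^ q).degree := by
      rw [degree_eq_natDegree hrφ, hr, degree_eq_natDegree, hdeg]
      intro h0; rw [h0, leadingCoeff_zero] at hlc
      exact hrφ (leadingCoeff_eq_zero.1 hlc.symm)
    have h3 := degree_sub_lt_left h2 hrφ hlc.symm
    by_cases h4 : φ r - C (a:R) * φ x ^ q = 0
    · rw [h4]; simpa using hm
    · rw [← hr]; exact natDegree_lt_natDegree h4 h3
  obtain ⟨p, hp⟩ := ih _ hlt _ rfl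
  refine ⟨p + C a * X ^ q, ?_⟩
  simp only [map_add, hp, map_mul, aeval_C, map_pow, aeval_X]
  exact sub_add_cancel _ _

section Graded
variable {R : Type u} [CommRing R]

/-- the part of `g` in degree exactly `c` -/
noncomputable def topPart (c : ℚ) (g : R[X]) : R[X] :=
  ∑ j ∈ g.support, if (j : ℚ) = c then monomial j (g.coeff j) else 0

theorem coeff_topPart (c : ℚ) (g : R[X]) (j : ℕ) :
    (topPart c g).coeff j = if (j : ℚ) = c then g.coeff j else 0 := by
  rw [topPart, finsetSum_coeff, Finset.sum_eq_single j]
  · split_ifs <;> simp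
  · intro b _ hb
    split_ifs
    · rw [coeff_monomial, if_neg hb]
    · simp
  · intro hj
    rw [notMem_support_iff] at hj
    split_ifs <;> simp [hj]

theorem topPart_add (c : ℚ) (f g : R[X]) : topPart c (f + g) = topPart c f + topPart c g := by
  ext j; simp only [coeff_topPart, coeff_add]; split_ifs <;> simp

theorem topPart_zero (c : ℚ) : topPart c (0 : R[X]) = 0 := by
  ext j; simp [coeff_topPart]

theorem topPart_natCast_mul (c : ℚ) (n : ℕ) (f : R[X]) :
    topPart c ((n : R[X]) * f) = (n : R[X]) * topPart c f := by
  ext j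
  rw [coeff_topPart, ← nsmul_eq_mul, ← nsmul_eq_mul, coeff_smul, coeff_smul, coeff_topPart]
  split_ifs <;> simp

theorem topPart_eq (c : ℚ) (g : R[X]) : ∃ (a : R) (u : ℕ), topPart c g = C a * X ^ u := by
  by_cases h : ∃ u : ℕ, (u : ℚ) = c
  · obtain ⟨u, rfl⟩ := h
    refine ⟨g.coeff u, u, ?_⟩
    ext j
    rw [coeff_topPart, coeff_C_mul_X_pow]
    by_cases hj : j = u <;> simp [hj]
  · push Not at h
    refine ⟨0, 0, ?_⟩
    ext j
    rw [coeff_topPart, if_neg (h j)]; simp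

/-- the weighted homogeneous component -/
noncomputable def wtop (w c : ℚ) (P : R[X][X]) : R[X][X] :=
  ∑ i ∈ P.support, monomial i (topPart (c + w * i) (P.coeff i))

theorem coeff_wtop (w c : ℚ) (P : R[X][X]) (i : ℕ) :
    (wtop w c P).coeff i = topPart (c + w * i) (P.coeff i) := by
  rw [wtop, finsetSum_coeff, Finset.sum_eq_single i]
  · simp
  · intro b _ hb
    rw [coeff_monomial, if_neg hb]
  · intro hj
    rw [notMem_support_iff] at hj
    simp [hj, topPart_zero]

/-- weighted degree bound -/
def Bd (w c : ℚ) (P : R[X][X]) : Prop :=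
  ∀ i j : ℕ, (P.coeff i).coeff j ≠ 0 → (j : ℚ) ≤ c + w * i

theorem wtop_add (w c : ℚ) (P Q : R[X][X]) : wtop w c (P + Q) = wtop w c P + wtop w c Q := by
  ext1 i; simp only [coeff_wtop, coeff_add, topPart_add]

theorem coeff2_mul (P Q : R[X][X]) (i j : ℕ) : ((P * Q).coeff i).coeff j =
    ∑ a ∈ Finset.HasAntidiagonal.antidiagonal i, ∑ b ∈ Finset.HasAntidiagonal.antidiagonal j,
      (P.coeff a.1).coeff b.1 * (Q.coeff a.2).coeff b.2 := by
  rw [coeff_mul, finsetSum_coeff]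
  simp only [coeff_mul]

theorem Bd.mul {w c d : ℚ} {P Q : R[X][X]} (hP : Bd w c P) (hQ : Bd w d Q) :
    Bd w (c + d) (P * Q) := by
  intro i j h
  rw [coeff2_mul] at h
  obtain ⟨a, ha, h⟩ := Finset.exists_ne_zero_of_sum_ne_zero h
  obtain ⟨b, hb, h⟩ := Finset.exists_ne_zero_of_sum_ne_zero h
  have h1 := hP _ _ (left_ne_zero_of_mul h)
  have h2 := hQ _ _ (right_ne_zero_of_mul h)
  rw [Finset.HasAntidiagonal.mem_antidiagonal] at ha hb
  rw [← ha, ← hb]; push_cast; linarith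

theorem Bd.add {w c : ℚ} {P Q : R[X][X]} (hP : Bd w c P) (hQ : Bd w c Q) :
    Bd w c (P + Q) := by
  intro i j h
  rw [coeff_add, coeff_add] at h
  by_cases h1 : (P.coeff i).coeff j = 0
  · exact hQ i j (by simpa [h1] using h)
  · exact hP i j h1

theorem Bd.CC (w : ℚ) (r : R) : Bd w 0 (C (C r)) := by
  intro i j h
  rw [coeff_C] at h
  split_ifs at h with hi
  · rw [coeff_C] at h
    split_ifs at h with hj
    · simp [hi, hj]
    · simp at h
  · simp at h

theorem Bd.pow {w : ℚ} {P : R[X][X]} (hP : Bd w 1 P) (m : ℕ) : Bd w m (P ^ m) := by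
  induction m with
  | zero => simpa using Bd.CC w (1 : R)
  | succ m ih => rw [pow_succ]; push_cast; exact ih.mul hP

theorem wtop_mul {w c d : ℚ} {P Q : R[X][X]} (hP : Bd w c P) (hQ : Bd w d Q) :
    wtop w (c + d) (P * Q) = wtop w c P * wtop w d Q := by
  ext i j
  rw [coeff_wtop, coeff_topPart, coeff2_mul, coeff2_mul]
  simp only [coeff_wtop, coeff_topPart]
  have key : ∀ a ∈ Finset.HasAntidiagonal.antidiagonal i,
      ∀ b ∈ Finset.HasAntidiagonal.antidiagonal j,
      (if (j : ℚ) = c + d + w * i then (P.coeff a.1).coeff b.1 * (Q.coeff a.2).coeff b.2 else 0) =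
      (if (b.1 : ℚ) = c + w * a.1 then (P.coeff a.1).coeff b.1 else 0) *
        (if (b.2 : ℚ) = d + w * a.2 then (Q.coeff a.2).coeff b.2 else 0) := by
    intro a ha b hb
    rw [Finset.HasAntidiagonal.mem_antidiagonal] at ha hb
    have ha' : (a.1 : ℚ) + a.2 = i := by exact_mod_cast ha
    have hb' : (b.1 : ℚ) + b.2 = j := by exact_mod_cast hb
    have hw : w * i = w * a.1 + w * a.2 := by rw [← ha']; ring
    by_cases hp : (P.coeff a.1).coeff b.1 = 0
    · simp [hp]
    by_cases hq : (Q.coeff a.2).coeff b.2 = 0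
    · simp [hq]
    have h1 := hP _ _ hp
    have h2 := hQ _ _ hq
    by_cases h3 : (j : ℚ) = c + d + w * i
    · rw [if_pos h3, if_pos (by linarith), if_pos (by linarith)]
    · rw [if_neg h3]
      by_cases h4 : (b.1 : ℚ) = c + w * a.1
      · rw [if_neg (c := (b.2 : ℚ) = _) (fun h5 => h3 (by linarith)), mul_zero]
      · rw [if_neg h4, zero_mul]
  rw [← Finset.sum_congr rfl fun a ha => Finset.sum_congr rfl (key a ha)]
  split_ifs <;> simp

theorem wtop_CC (w : ℚ) (r : R) : wtop w 0 (C (C r) : R[X][X]) = C (C r) := by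
  ext i j
  rw [coeff_wtop, coeff_topPart, coeff_C]
  by_cases hi : i = 0
  · subst hi
    rw [if_pos rfl, coeff_C]
    by_cases hj : j = 0 <;> simp [hj]
  · simp [hi]

theorem wtop_eq_zero {w c d : ℚ} {P : R[X][X]} (hP : Bd w c P) (hd : c < d) : wtop w d P = 0 := by
  ext i j
  rw [coeff_wtop, coeff_topPart]
  split_ifs with h
  · by_contra h0
    have := hP i j h0
    linarith
  · simp

end Graded

theorem aux_weight {k : Type*} {R : Type u} [Field k] [CommRing R] [Algebra k R]
    (φ : R[X] →ₐ[k] R[X][X]) (h : IsExpMap φ) (G : Finset R)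
    (hG : Algebra.adjoin k (G : Set R) = ⊤)
    (hnt : ∃ r, φ (C r) ≠ C (C r)) :
    ∃ w : ℚ, (∀ r ∈ G, Bd w 0 (φ (C r))) ∧ Bd w 1 (φ X) ∧
      ((∃ r, ∃ i j : ℕ, 1 ≤ i ∧ ((φ (C r)).coeff i).coeff j ≠ 0 ∧ (j : ℚ) = w * i) ∨
        (∃ i j : ℕ, 1 ≤ i ∧ ((φ X).coeff i).coeff j ≠ 0 ∧ (j : ℚ) = 1 + w * i)) := by
  let V : ℚ → R[X][X] → Set ℚ := fun c P =>
    {q | ∃ i ∈ P.support, ∃ j ∈ (P.coeff i).support, 1 ≤ i ∧ q = ((j : ℚ) - c) / i}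
  have hVfin : ∀ c P, (V c P).Finite := by
    intro c P
    have : V c P ⊆ ⋃ i ∈ P.support, ⋃ j ∈ (P.coeff i).support, {((j : ℚ) - c) / i} := by
      rintro q ⟨i, hi, j, hj, -, rfl⟩
      simp only [Set.mem_iUnion]
      exact ⟨i, hi, j, hj, rfl⟩
    refine Set.Finite.subset ?_ this
    refine Set.Finite.biUnion P.support.finite_toSet fun i _ => ?_
    exact Set.Finite.biUnion (P.coeff i).support.finite_toSet fun j _ => Set.finite_singleton _
  have hVmem : ∀ c P (i j : ℕ), 1 ≤ i → (P.coeff i).coeff j ≠ 0 → ((j : ℚ) - c) / i ∈ V c P := by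
    intro c P i j hi hj
    refine ⟨i, ?_, j, ?_, hi, rfl⟩
    · rw [mem_support_iff]; intro h0; simp [h0] at hj
    · rwa [mem_support_iff]
  let W : Set ℚ := (⋃ r ∈ G, V 0 (φ (C r))) ∪ V 1 (φ X)
  have hWfin : W.Finite := (Set.Finite.biUnion G.finite_toSet fun r _ => hVfin _ _).union (hVfin _ _)
  have hne : W.Nonempty := by
    by_contra hemp
    rw [Set.not_nonempty_iff_eq_empty] at hemp
    have hGr : ∀ r ∈ G, φ (C r) = C (C r) := by
      intro r hr
      ext i j
      rcases Nat.eq_zero_or_pos i with rfl | hi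
      · rw [h.zero]; simp
      · rw [coeff_C, if_neg hi.ne', coeff_zero]
        by_contra h0
        have : ((j : ℚ) - 0) / i ∈ W := by
          left
          simp only [Set.mem_iUnion]
          exact ⟨r, hr, hVmem _ _ _ _ hi h0⟩
        rw [hemp] at this
        exact this
    obtain ⟨r, hr⟩ := hnt
    apply hr
    have h2 : (⊤ : Subalgebra k R) ≤
        AlgHom.equalizer (φ.comp CAlgHom) ((CAlgHom : R[X] →ₐ[k] R[X][X]).comp CAlgHom) := by
      rw [← hG, Algebra.adjoin_le_iff]
      intro r hr
      exact hGr r hr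
    exact h2 (show r ∈ ⊤ from trivial)
  obtain ⟨w, hw, hmax⟩ := Set.exists_max_image W id hWfin hne
  have hbd : ∀ c P, V c P ⊆ W → (∀ j : ℕ, (P.coeff 0).coeff j ≠ 0 → (j : ℚ) ≤ c) → Bd w c P := by
    intro c P hVW h0 i j hij
    rcases Nat.eq_zero_or_pos i with rfl | hi
    · simpa using h0 j hij
    · have := hmax _ (hVW (hVmem c P i j hi hij))
      simp only [id] at this
      have hi' : (0 : ℚ) < i := by exact_mod_cast hi
      rw [div_le_iff₀ hi'] at this
      linarith
  refine ⟨w, ?_, ?_, ?_⟩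
  · intro r hr
    apply hbd
    · intro q hq; left; simp only [Set.mem_iUnion]; exact ⟨r, hr, hq⟩
    · intro j hj
      rw [h.zero, coeff_C] at hj
      split_ifs at hj with h1
      · simp [h1]
      · simp at hj
  · apply hbd
    · intro q hq; right; exact hq
    · intro j hj
      rw [h.zero, coeff_X] at hj
      split_ifs at hj with h1
      · simp [← h1]
      · simp at hj
  · rcases hw with hw | hw
    · left
      simp only [Set.mem_iUnion] at hw
      obtain ⟨r, hr, i, hi, j, hj, hi1, rfl⟩ := hw
      refine ⟨r, i, j, hi1, by simpa using hj, ?_⟩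
      have : (i : ℚ) ≠ 0 := by exact_mod_cast (by omega : i ≠ 0)
      field_simp
      simp
    · right
      obtain ⟨i, hi, j, hj, hi1, rfl⟩ := hw
      refine ⟨i, j, hi1, by simpa using hj, ?_⟩
      have : (i : ℚ) ≠ 0 := by exact_mod_cast (by omega : i ≠ 0)
      field_simp
      simp

theorem aux_graded {k : Type*} {R : Type u} [Field k] [CommRing R] [IsDomain R] [Algebra k R]
    (hfg : Algebra.FiniteType k R)
    (φ : R[X] →ₐ[k] R[X][X]) (h : IsExpMap φ) (hnt : ∃ r, φ (C r) ≠ C (C r)) :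
    ∃ δ : R →ₐ[k] R[X], IsExpMap δ ∧ ∃ r, δ r ≠ C r := by
  obtain ⟨G, hG⟩ := hfg.out
  obtain ⟨w, hw1, hwX, hatt⟩ := aux_weight φ h G hG hnt
  have hφalg : ∀ c : k, φ (C (algebraMap k R c)) = C (C (algebraMap k R c)) := by
    intro c
    exact φ.commutes c
  have hwC : ∀ r, Bd w 0 (φ (C r)) := by
    let B : Subalgebra k R :=
      { carrier := {r | Bd w 0 (φ (C r))}
        mul_mem' := by
          intro a b ha hb
          have := Bd.mul ha hb
          simp only [Set.mem_ofPred_eq, map_mul]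
          simpa using this
        add_mem' := by
          intro a b ha hb
          have := Bd.add ha hb
          simpa using this
        algebraMap_mem' := by
          intro c
          simp only [Set.mem_ofPred_eq, hφalg]
          exact Bd.CC _ _ }
    have : (⊤ : Subalgebra k R) ≤ B := by
      rw [← hG, Algebra.adjoin_le_iff]
      exact fun r hr => hw1 r hr
    exact fun r => this (show r ∈ ⊤ from trivial)
  have hbd : ∀ (m : ℕ) (r : R), Bd w m (φ (C r * X ^ m)) := by
    intro m r
    have := (hwC r).mul (hwX.pow m)
    simpa using this
  have hw0 : 0 ≤ w := by
    by_contra hneg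
    push Not at hneg
    obtain ⟨r, hr⟩ := hnt
    apply hr
    ext1 i
    rcases Nat.eq_zero_or_pos i with rfl | hi
    · rw [h.zero]; simp
    · rw [coeff_C, if_neg hi.ne']
      ext j
      by_contra h0
      have := hwC r i j (by simpa using h0)
      have hi' : (0 : ℚ) < i := by exact_mod_cast hi
      have hj' : (0 : ℚ) ≤ j := Nat.cast_nonneg j
      nlinarith
  let ρ : R →ₐ[k] R[X][X] :=
    { toFun := fun r => wtop w 0 (φ (C r))
      map_one' := by
        have := wtop_CC w (1 : R)
        simpa using this
      map_zero' := by
        have := wtop_CC w (0 : R)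
        simpa using this
      map_add' := by intro a b; simp [wtop_add]
      map_mul' := by
        intro a b
        have := wtop_mul (hwC a) (hwC b)
        simpa using this
      commutes' := by
        intro c
        change wtop w 0 (φ (C (algebraMap k R c))) = _
        rw [hφalg, wtop_CC]
        rfl }
  have hρ : ∀ r, ρ r = wtop w 0 (φ (C r)) := fun r => rfl
  let ξ : R[X][X] := wtop w 1 (φ X)
  let ψ : R[X] →+* R[X][X] := eval₂RingHom ρ.toRingHom ξ
  have hψX : ψ X = ξ := by simp [ψ]
  have hψC : ∀ r, ψ (C r) = ρ r := by intro r; simp [ψ]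
  have hpow : ∀ m : ℕ, wtop w m (φ X ^ m) = ξ ^ m := by
    intro m
    induction m with
    | zero => simpa using wtop_CC w (1 : R)
    | succ m ih =>
      rw [pow_succ, pow_succ, ← ih]
      push_cast
      exact wtop_mul (hwX.pow m) hwX
  have hψm : ∀ (m : ℕ) (r : R), ψ (C r * X ^ m) = wtop w m (φ (C r * X ^ m)) := by
    intro m r
    rw [map_mul, map_pow, map_mul, map_pow, hψX, hψC, hρ, ← hpow]
    have := wtop_mul (hwC r) (hwX.pow m)
    rw [zero_add] at this
    exact this.symm
  have htop : ∀ (c : ℚ) (g : R[X]), (∀ u : ℕ, g.coeff u ≠ 0 → (u : ℚ) ≤ c) →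
      ψ (topPart c g) = wtop w c (φ g) := by
    intro c g hg
    have hsum : ∀ s : Finset ℕ, (∀ u ∈ s, (u : ℚ) ≤ c) → 
        ψ (topPart c (∑ u ∈ s, C (g.coeff u) * X ^ u)) =
          wtop w c (φ (∑ u ∈ s, C (g.coeff u) * X ^ u)) := by
      intro s
      induction s using Finset.induction_on with
      | empty =>
        intro _
        have : wtop w c (0 : R[X][X]) = 0 := by ext1 i; simp [coeff_wtop, topPart_zero]
        simp [topPart_zero, this]
      | insert a s ha ih =>
        intro hs
        rw [Finset.sum_insert ha, topPart_add, map_add, map_add, wtop_add,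
          ih fun u hu => hs u (Finset.mem_insert_of_mem hu)]
        congr 1
        rcases (hs a (Finset.mem_insert_self _ _)).eq_or_lt with h1 | h1
        · have : topPart c (C (g.coeff a) * X ^ a) = C (g.coeff a) * X ^ a := by
            ext j
            rw [coeff_topPart, coeff_C_mul_X_pow]
            by_cases hj : j = a
            · simp [hj, h1]
            · simp [hj]
          rw [this, hψm, h1]
        · have : topPart c (C (g.coeff a) * X ^ a) = 0 := by
            ext j
            rw [coeff_topPart, coeff_C_mul_X_pow]
            by_cases hj : j = a
            · simp [hj, h1.ne]
            · simp [hj]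
          rw [this, wtop_eq_zero (hbd a _) h1, map_zero]
    have := hsum g.support (fun u hu => hg u (by simpa using hu))
    rwa [← g.as_sum_support_C_mul_X_pow] at this
  have hiter : ∀ m r i j, (ψ ((ψ (C r * X ^ m)).coeff j)).coeff i =
      ((i + j).choose i : R[X]) * (ψ (C r * X ^ m)).coeff (i + j) := by
    intro m r i j
    rw [hψm, coeff_wtop, coeff_wtop, htop _ _ (fun u hu => hbd m r j u hu), coeff_wtop, h.iter,
      topPart_natCast_mul]
    congr 2
    push_cast; ring
  have hξ0 : ξ.coeff 0 = X := by
    rw [coeff_wtop, h.zero]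
    ext j
    rw [coeff_topPart, coeff_X]
    by_cases hj : j = 1
    · simp [hj]
    · simp [Ne.symm hj]
  have hiterX : ∀ i j, (ψ (ξ.coeff j)).coeff i =
      ((i + j).choose i : R[X]) * ξ.coeff (i + j) := by
    intro i j
    have := hiter 1 1 i j
    simpa [hψX] using this
  have hXdvd : ∀ j, X ∣ ξ.coeff j := by
    intro j
    rw [X_dvd_iff, coeff_wtop, coeff_topPart, if_neg]
    have : 0 ≤ w * j := mul_nonneg hw0 (Nat.cast_nonneg _)
    push_cast
    linarith
  have hξ : ξ = C X := by
    have hξne : ξ ≠ 0 := by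
      intro h0; rw [h0] at hξ0; simp at hξ0; exact X_ne_zero hξ0.symm
    have hdeg : ξ.natDegree = 0 := by
      obtain ⟨f, hf⟩ := hXdvd ξ.natDegree
      have h1 : (ψ (ξ.coeff ξ.natDegree)).natDegree = 0 := by
        rw [← Nat.le_zero, natDegree_le_iff_coeff_eq_zero]
        intro N hN
        rw [hiterX, coeff_eq_zero_of_natDegree_lt (by omega), mul_zero]
      have h2 : ψ (ξ.coeff ξ.natDegree) ≠ 0 := by
        intro h0
        have := hiterX 0 ξ.natDegree
        rw [h0] at this
        simp at this
        exact hξne (leadingCoeff_eq_zero.1 this.symm)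
      rw [hf, map_mul, hψX] at h1 h2
      rw [natDegree_mul (left_ne_zero_of_mul h2) (right_ne_zero_of_mul h2)] at h1
      omega
    rw [eq_C_of_natDegree_eq_zero hdeg, hξ0]
  let δ : R →ₐ[k] R[X] := (mapAlgHom ((aeval (R := R) (1:R)).restrictScalars k)).comp ρ
  have hδ : ∀ r i, (δ r).coeff i = eval 1 ((ρ r).coeff i) := by
    intro r i
    simp [δ, coe_aeval_eq_eval]
  refine ⟨δ, ⟨?_, ?_⟩, ?_⟩
  · intro r
    rw [hδ, hρ, coeff_wtop, h.zero]
    have : topPart (0 + w * (0:ℕ)) (C r) = C r := by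
      ext j
      rw [coeff_topPart, coeff_C]
      by_cases hj : j = 0 <;> simp [hj]
    rw [this, eval_C]
  · intro r i j
    have h1 := hiter 0 r i j
    simp only [pow_zero, mul_one, hψC] at h1
    obtain ⟨a, u, hau⟩ := topPart_eq (0 + w * j) ((φ (C r)).coeff j)
    have h2 : (ρ r).coeff j = C a * X ^ u := by rw [hρ, coeff_wtop, hau]
    have h3 : (δ r).coeff j = a := by rw [hδ, h2]; simp
    rw [h2, map_mul, map_pow, hψX, hξ, hψC, ← C_pow, coeff_mul_C] at h1
    rw [h3, hδ, hδ]
    have h4 := congrArg (eval 1) h1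
    simpa using h4
  · rcases hatt with ⟨r, i, j, hi, hne, hj⟩ | ⟨i, j, hi, hne, hj⟩
    · refine ⟨r, fun h0 => ?_⟩
      have h1 : (δ r).coeff i = 0 := by rw [h0, coeff_C, if_neg (by omega)]
      rw [hδ, hρ, coeff_wtop] at h1
      have h2 : topPart (0 + w * i) ((φ (C r)).coeff i) = 
          C (((φ (C r)).coeff i).coeff j) * X ^ j := by
        ext l
        rw [coeff_topPart, coeff_C_mul_X_pow, zero_add, ← hj]
        by_cases hl : l = j <;> simp [hl]
      rw [h2] at h1
      simp at h1
      exact hne h1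
    · exfalso
      have h1 : ξ.coeff i = 0 := by rw [hξ, coeff_C, if_neg (by omega)]
      rw [coeff_wtop] at h1
      have h2 := congrArg (fun f => coeff f j) h1
      simp only [coeff_topPart, if_pos hj, coeff_zero] at h2
      exact hne h2

theorem aux_taylor (k S : Type*) [Field k] [CommRing S] [Algebra k S] :
    ∃ φ : S[X] →ₐ[k] S[X][X], IsExpMap φ ∧ ∀ f, φ f = C f → ∃ s, f = C s := by
  let φ : S[X] →ₐ[k] S[X][X] :=
    ((taylorAlgHom (X : S[X])).restrictScalars k).comp (mapAlgHom CAlgHom)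
  have hco : ∀ f n, (φ f).coeff n = hasseDeriv n f := by
    intro f n
    have : φ f = taylor X (f.map C) := rfl
    rw [this, taylor_coeff]
    have h2 : hasseDeriv n (f.map C) = (hasseDeriv n f).map (C : S →+* S[X]) := by
      ext1 i
      simp [hasseDeriv_coeff]
    rw [h2, eval_map, eval₂_C_X]
  refine ⟨φ, ⟨?_, ?_⟩, ?_⟩
  · intro f; rw [hco, hasseDeriv_zero']
  · intro f i j
    rw [hco, hco, hco]
    have := congrArg (fun g => g f) (hasseDeriv_comp (R := S) i j)
    simpa using this
  · intro f hf
    rcases Nat.eq_zero_or_pos f.natDegree with h0 | h0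
    · exact ⟨_, eq_C_of_natDegree_eq_zero h0⟩
    · have h1 := hco f f.natDegree
      rw [hf, coeff_C, if_neg h0.ne', hasseDeriv_natDegree_eq_C] at h1
      have : f.leadingCoeff = 0 := by simpa using h1.symm
      rw [leadingCoeff_eq_zero] at this
      simp [this] at h0

theorem aux_dichotomy {k : Type*} {R : Type u} {S : Type v} [Field k]
    [CommRing R] [IsDomain R] [Algebra k R] [CommRing S] [IsDomain S] [Algebra k S]
    (hfgR : Algebra.FiniteType k R) (hdimR : ringKrullDim R = 1)
    (e : R[X] ≃ₐ[k] S[X]) : (∀ r, ∃ s, e (C r) = C s) ∨ IsPolyFin k R := by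
  by_cases hcase : ∀ r, ∃ s, e (C r) = C s
  · exact Or.inl hcase
  right
  obtain ⟨φ, hφ, hφC⟩ := aux_taylor k S
  let Φ : R[X] →ₐ[k] R[X][X] := (mapAlgHom e.symm.toAlgHom).comp (φ.comp e.toAlgHom)
  have hco : ∀ f n, (Φ f).coeff n = e.symm ((φ (e f)).coeff n) := by
    intro f n; simp [Φ]
  have hΦ : IsExpMap Φ := by
    constructor
    · intro r; rw [hco, hφ.zero]; simp
    · intro r i j
      rw [hco, hco, hco, AlgEquiv.apply_symm_apply, hφ.iter]
      simp
  have hnt : ∃ r, Φ (C r) ≠ C (C r) := by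
    by_contra hall
    push Not at hall
    apply hcase
    intro r
    apply hφC
    ext1 n
    have := hco (C r) n
    rw [hall r] at this
    rw [← e.apply_symm_apply ((φ (e (C r))).coeff n), ← this]
    rw [coeff_C, coeff_C]
    split_ifs <;> simp
  obtain ⟨δ, hδ, hδnt⟩ := aux_graded hfgR Φ hΦ hnt
  exact aux_exp_poly hfgR hdimR δ hδ hδnt

theorem aux_krull {R : Type*} [CommRing R] (hdim : ringKrullDim R = 1) : Ring.KrullDimLE 1 R := by
  rw [Ring.krullDimLE_iff, hdim]; rfl

theorem aux_contained {k : Type*} {R : Type u} {S : Type v} [Field k]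
    [CommRing R] [IsDomain R] [Algebra k R] [CommRing S] [IsDomain S] [Algebra k S]
    (hdimR : ringKrullDim R = 1) (hdimS : ringKrullDim S = 1)
    (e : R[X] ≃ₐ[k] S[X]) (h : ∀ r, ∃ s, e (C r) = C s) : Nonempty (S ≃ₐ[k] R) := by
  let g : S →ₐ[k] R := ((aeval (R := R) (0:R)).restrictScalars k).comp (e.symm.toAlgHom.comp CAlgHom)
  have hs : Function.Surjective g := by
    intro r
    obtain ⟨s, hs⟩ := h r
    refine ⟨s, ?_⟩
    simp [g, ← hs]
  exact ⟨AlgEquiv.ofBijective g ⟨aux_surj_inj (aux_krull hdimS) hdimR g.toRingHom hs, hs⟩⟩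

theorem aux_comm {k : Type*} {R : Type u} {S : Type v} [Field k]
    [CommRing R] [IsDomain R] [Algebra k R] [CommRing S] [IsDomain S] [Algebra k S]
    (hfgR : Algebra.FiniteType k R) (hdimR : ringKrullDim R = 1)
    (hfgS : Algebra.FiniteType k S) (hdimS : ringKrullDim S = 1)
    (e : R[X] ≃ₐ[k] S[X]) : Nonempty (R ≃ₐ[k] S) := by
  rcases aux_dichotomy hfgR hdimR e with h | h
  · obtain ⟨f⟩ := aux_contained hdimR hdimS e h
    exact ⟨f.symm⟩
  rcases aux_dichotomy hfgS hdimS e.symm with h' | h'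
  · exact aux_contained hdimS hdimR e.symm h'
  exact aux_iso_of_polyFin h h' (e.toAlgHom.comp CAlgHom) (e.symm.toAlgHom.comp CAlgHom)

theorem aux_equiv {R T : Type*} [CommRing R] [Ring T] (ι : R →+* T) (x : T)
    (hrep : ∀ t : T, ∃! b : ℕ →₀ R, t = b.sum fun i r => ι r * x ^ i) :
    ∃ E : (ℕ →₀ R) ≃+ T, ∀ i r, E (Finsupp.single i r) = ι r * x ^ i := by
  let F : (ℕ →₀ R) →+ T :=
    Finsupp.liftAddHom fun i => (AddMonoidHom.mulRight (x ^ i)).comp ι.toAddMonoidHom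
  have hF : ∀ b, F b = b.sum fun i r => ι r * x ^ i := fun b => rfl
  have hb : Function.Bijective F := by
    constructor
    · intro a b hab
      obtain ⟨c, hc, hu⟩ := hrep (F a)
      rw [hu a (hF a), hu b (by simp only [hab, hF])]
    · intro t
      obtain ⟨c, hc, hu⟩ := hrep t
      exact ⟨c, hc.symm⟩
  refine ⟨AddEquiv.ofBijective F hb, ?_⟩
  intro i r
  simp [F]

theorem aux_proj {k R T : Type*} [Field k] [CommRing R] [Algebra k R] [Ring T] [Algebra k T]
    (σ : R ≃ₐ[k] R) (ι : R →ₐ[k] T) (x : T)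
    (hrep : ∀ t : T, ∃! b : ℕ →₀ R, t = b.sum fun i r => ι r * x ^ i)
    (hcomm : ∀ r : R, x * ι r = ι (σ r) * x) :
    ∃ π : T →ₐ[k] R, (∀ r, π (ι r) = r) ∧ π x = 0 := by
  obtain ⟨E, hE⟩ := aux_equiv ι.toRingHom x hrep
  have hE : ∀ i r, E (Finsupp.single i r) = ι r * x ^ i := hE
  have hind : ∀ P : T → Prop, (∀ i r, P (ι r * x ^ i)) → (∀ a b, P a → P b → P (a + b)) →
      ∀ t, P t := by
    intro P h1 h2 t
    rw [← E.apply_symm_apply t]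
    induction E.symm t using Finsupp.induction_linear with
    | zero => have := h1 0 0; simpa using this
    | add f g hf hg => rw [map_add]; exact h2 _ _ hf hg
    | single i r => rw [hE]; exact h1 i r
  let p : T →+ R := (Finsupp.applyAddHom 0).comp E.symm.toAddMonoidHom
  have hp : ∀ i r, p (ι r * x ^ i) = if i = 0 then r else 0 := by
    intro i r
    have : E.symm (ι r * x ^ i) = Finsupp.single i r := by rw [← hE, E.symm_apply_apply]
    simp [p, this, Finsupp.single_apply]
  have hpι : ∀ r, p (ι r) = r := by
    intro r; simpa using hp 0 r
  have h1 : ∀ r t, p (ι r * t) = r * p t := by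
    intro r
    apply hind
    · intro i s
      rw [← mul_assoc, ← map_mul, hp, hp]; split_ifs <;> simp
    · intro a b ha hb; rw [mul_add, map_add, ha, hb, map_add, mul_add]
  have h2 : ∀ t, p (x * t) = 0 := by
    apply hind
    · intro i s
      rw [← mul_assoc, hcomm, mul_assoc, ← pow_succ', hp]; simp
    · intro a b ha hb; rw [mul_add, map_add, ha, hb, add_zero]
  have h3 : ∀ u t, p (t * u) = p t * p u := by
    intro u
    apply hind
    · intro i r
      rw [mul_assoc, h1, hp]
      split_ifs with hi
      · simp [hi]
      · obtain ⟨n, rfl⟩ := Nat.exists_eq_succ_of_ne_zero hi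
        rw [Nat.succ_eq_add_one, pow_succ', mul_assoc, h2]; simp
    · intro a b ha hb; rw [add_mul, map_add, ha, hb, map_add, add_mul]
  let π : T →ₐ[k] R :=
    { toFun := p
      map_one' := by rw [← map_one ι, hpι]
      map_zero' := map_zero p
      map_add' := map_add p
      map_mul' := fun a b => h3 b a
      commutes' := fun c => by rw [← ι.commutes c, hpι] }
  refine ⟨π, hpι, ?_⟩
  have := h2 1
  rw [mul_one] at this
  exact this

theorem aux_surj_gen {k R T B : Type*} [Field k] [CommRing R] [Algebra k R] [Ring T] [Algebra k T]
    [CommRing B] [Algebra k B] (ι : R →ₐ[k] T) (x : T)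
    (hrep : ∀ t : T, ∃! b : ℕ →₀ R, t = b.sum fun i r => ι r * x ^ i)
    (q : T →ₐ[k] B) (hq : Function.Surjective q) (L : Subalgebra k B)
    (hL : ∀ r, q (ι r) ∈ L) : Function.Surjective (aeval (R := L) (q x)) := by
  intro b
  obtain ⟨t, rfl⟩ := hq b
  obtain ⟨c, hc, -⟩ := hrep t
  refine ⟨∑ i ∈ c.support, C (⟨q (ι (c i)), hL _⟩ : L) * X ^ i, ?_⟩
  rw [hc, Finsupp.sum, map_sum, map_sum]
  refine Finset.sum_congr rfl fun i _ => ?_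
  rw [map_mul, map_mul, map_pow, map_pow, aeval_C, aeval_X]
  rfl

theorem aux_noncomm {k : Type*} {R : Type u} {S : Type v} {T' : Type*} [Field k]
    [CommRing R] [IsDomain R] [Algebra k R] [CommRing S] [IsDomain S] [Algebra k S]
    [Ring T'] [Algebra k T']
    (hfgR : Algebra.FiniteType k R) (hdimR : ringKrullDim R = 1)
    (hdimS : ringKrullDim S = 1) (σ' : S ≃ₐ[k] S) (hσ : ∃ s, σ' s ≠ s)
    (ι' : S →ₐ[k] T') (x' : T')
    (hrep' : ∀ t : T', ∃! b : ℕ →₀ S, t = b.sum fun i s => ι' s * x' ^ i)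
    (hcomm' : ∀ s : S, x' * ι' s = ι' (σ' s) * x')
    (q : T' →ₐ[k] R) (hq : Function.Surjective q) : Nonempty (S ≃ₐ[k] R) ∨ IsPolyFin k R := by
  let g : S →ₐ[k] R := q.comp ι'
  have hg : ∀ s, g s = q (ι' s) := fun s => rfl
  by_cases hz : q x' = 0
  · left
    have hs : Function.Surjective g := by
      intro r
      obtain ⟨p, hp⟩ := aux_surj_gen ι' x' hrep' q hq g.range (fun s => ⟨s, rfl⟩) r
      rw [hz] at hp
      obtain ⟨s, hs⟩ := (p.coeff 0).2
      refine ⟨s, ?_⟩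
      rw [← hp, ← coeff_zero_eq_aeval_zero']
      exact hs
    exact ⟨AlgEquiv.ofBijective g ⟨aux_surj_inj (aux_krull hdimS) hdimR g.toRingHom hs, hs⟩⟩
  · right
    obtain ⟨s, hs⟩ := hσ
    have hker : g (σ' s - s) = 0 := by
      have h1 := congrArg q (hcomm' s)
      rw [map_mul, map_mul, mul_comm, ← hg, ← hg] at h1
      rw [map_sub, mul_right_cancel₀ hz h1.symm, sub_self] 
    have hP : (RingHom.ker g).IsPrime := RingHom.ker_isPrime _
    have := aux_krull hdimS
    have hM : (RingHom.ker g).IsMaximal := hP.isMaximal_of_ne_bot (by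
      intro h0
      have : σ' s - s ∈ RingHom.ker g := hker
      rw [h0] at this
      exact hs (sub_eq_zero.1 this))
    have hF : IsField g.range := by
      have := (Ideal.Quotient.maximal_ideal_iff_isField_quotient _).1 hM
      exact MulEquiv.isField this (Ideal.quotientKerEquivRange g).symm.toMulEquiv
    exact aux_polyFin hfgR hdimR g.range hF (q x')
      (aux_surj_gen ι' x' hrep' q hq g.range (fun s => ⟨s, rfl⟩))

theorem aux_polyEquiv {k R T : Type*} [Field k] [CommRing R] [Algebra k R] [Ring T] [Algebra k T]
    (ι : R →ₐ[k] T) (x : T)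
    (hrep : ∀ t : T, ∃! b : ℕ →₀ R, t = b.sum fun i r => ι r * x ^ i)
    (hcomm : ∀ r : R, x * ι r = ι r * x) : Nonempty (R[X] ≃ₐ[k] T) := by
  let f : R[X] →ₐ[k] T :=
    { eval₂RingHom' (ι : R →+* T) x (fun r => (hcomm r).symm) with
      commutes' := fun c => by
        change eval₂ (ι : R →+* T) x (C (algebraMap k R c)) = _
        rw [eval₂_C]
        exact ι.commutes c }
  obtain ⟨E, hE⟩ := aux_equiv ι.toRingHom x hrep
  have hf : ∀ p : R[X], f p = E (∑ i ∈ p.support, Finsupp.single i (p.coeff i)) := by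
    intro p
    rw [map_sum]
    simp only [hE]
    change eval₂ _ _ _ = _
    rw [eval₂_eq_sum, Polynomial.sum]
    rfl
  refine ⟨AlgEquiv.ofBijective f ⟨?_, ?_⟩⟩
  · rw [injective_iff_map_eq_zero]
    intro p hp
    rw [hf, map_eq_zero_iff E E.injective] at hp
    ext j
    have h1 := DFunLike.congr_fun hp j
    rw [Finsupp.finsetSum_apply] at h1
    simp only [Finsupp.single_apply, Finset.sum_ite_eq', mem_support_iff] at h1
    by_cases hj : p.coeff j = 0
    · simp [hj]
    · simpa [hj] using h1
  · intro t
    obtain ⟨c, hc, -⟩ := hrep t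
    refine ⟨∑ i ∈ c.support, C (c i) * X ^ i, ?_⟩
    rw [hc, Finsupp.sum, map_sum]
    refine Finset.sum_congr rfl fun i _ => ?_
    have hC : f (C (c i)) = ι (c i) := eval₂_C _ _
    have hX : f X = x := eval₂_X _ _
    rw [map_mul, map_pow, hC, hX]

theorem aux_sigma {k R T : Type*} [Field k] [CommRing R] [Algebra k R] [Ring T] [Algebra k T]
    (σ : R ≃ₐ[k] R) (ι : R →ₐ[k] T) (x : T)
    (hrep : ∀ t : T, ∃! b : ℕ →₀ R, t = b.sum fun i r => ι r * x ^ i)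
    (hcomm : ∀ r : R, x * ι r = ι (σ r) * x) (hT : ∀ a b : T, a * b = b * a) (r : R) :
    σ r = r := by
  obtain ⟨E, hE⟩ := aux_equiv ι.toRingHom x hrep
  have h1 : E (Finsupp.single 1 (σ r)) = E (Finsupp.single 1 r) := by
    rw [hE, hE, pow_one]
    exact (hcomm r).symm.trans (hT _ _)
  exact Finsupp.single_injective 1 (E.injective h1)

end AuxAll


/-- Skew cancellation, automorphism type: if `R`, `S` are affine commutative
domains of Krull dimension one over `k` with automorphisms `σ`, `σ'`, and the
skew polynomial rings `R[x; σ]` and `S[x'; σ']` are isomorphic as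
`k`-algebras, then `R ≅ S`. -/
theorem stmt_15 (k R S T T' : Type*) [Field k]
    [CommRing R] [IsDomain R] [Algebra k R]
    [CommRing S] [IsDomain S] [Algebra k S]
    [Ring T] [Algebra k T] [Ring T'] [Algebra k T']
    (hfgR : Algebra.FiniteType k R) (hdimR : ringKrullDim R = 1)
    (hfgS : Algebra.FiniteType k S) (hdimS : ringKrullDim S = 1)
    (σ : R ≃ₐ[k] R) (σ' : S ≃ₐ[k] S)
    (ι : R →ₐ[k] T) (hι : Function.Injective ι) (x : T)
    (hrep : ∀ t : T, ∃! b : ℕ →₀ R, t = b.sum fun i r => ι r * x ^ i)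
    (hcomm : ∀ r : R, x * ι r = ι (σ r) * x)
    (ι' : S →ₐ[k] T') (hι' : Function.Injective ι') (x' : T')
    (hrep' : ∀ t : T', ∃! b : ℕ →₀ S, t = b.sum fun i s => ι' s * x' ^ i)
    (hcomm' : ∀ s : S, x' * ι' s = ι' (σ' s) * x')
    (hiso : Nonempty (T ≃ₐ[k] T')) :
    Nonempty (R ≃ₐ[k] S) := by
  obtain ⟨Θ⟩ := hiso
  by_cases hσ : ∀ r, σ r = r
  · have hc : ∀ r, x * ι r = ι r * x := fun r => by rw [hcomm, hσ]
    obtain ⟨e⟩ := aux_polyEquiv ι x hrep hc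
    have hT' : ∀ a b : T', a * b = b * a := by
      intro a b
      apply (e.trans Θ).symm.injective
      rw [map_mul, map_mul, mul_comm]
    have hσ' := aux_sigma σ' ι' x' hrep' hcomm' hT'
    have hc' : ∀ r, x' * ι' r = ι' r * x' := fun r => by rw [hcomm', hσ']
    obtain ⟨e'⟩ := aux_polyEquiv ι' x' hrep' hc'
    exact aux_comm hfgR hdimR hfgS hdimS ((e.trans Θ).trans e'.symm)
  · have hσ' : ¬ ∀ s, σ' s = s := by
      intro hσ'
      apply hσ
      have hc' : ∀ r, x' * ι' r = ι' r * x' := fun r => by rw [hcomm', hσ']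
      obtain ⟨e'⟩ := aux_polyEquiv ι' x' hrep' hc'
      have hT : ∀ a b : T, a * b = b * a := by
        intro a b
        apply (Θ.trans e'.symm).injective
        rw [map_mul, map_mul, mul_comm]
      exact aux_sigma σ ι x hrep hcomm hT
    push Not at hσ hσ'
    obtain ⟨π, hπ, -⟩ := aux_proj σ ι x hrep hcomm
    obtain ⟨π', hπ', -⟩ := aux_proj σ' ι' x' hrep' hcomm'
    have hq1 : Function.Surjective (π.comp Θ.symm.toAlgHom) := fun r => ⟨Θ (ι r), by simp [hπ]⟩
    have hq2 : Function.Surjective (π'.comp Θ.toAlgHom) := fun s => ⟨Θ.symm (ι' s), by simp [hπ']⟩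
    rcases aux_noncomm hfgR hdimR hdimS σ' hσ' ι' x' hrep' hcomm' _ hq1 with ⟨⟨f⟩⟩ | hR
    · exact ⟨f.symm⟩
    rcases aux_noncomm hfgS hdimS hdimR σ hσ ι x hrep hcomm _ hq2 with h | hS
    · exact h
    exact aux_iso_of_polyFin hR hS
      (Polynomial.CAlgHom.comp ((π'.comp Θ.toAlgHom).comp ι))
      (Polynomial.CAlgHom.comp ((π.comp Θ.symm.toAlgHom).comp ι'))
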